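/- arXiv:2308.08394 — 4 statements merged into one kernel-verified Lean document; each statement's English description precedes it below -/
import Mathlib

section
/- Let m ∈ (0,1) and let u : (0,∞) → ℝ be a nonnegative continuous function such that the map t ↦ t^(-1/(1-m)) · u(t) is antitone (non-increasing) on (0,∞). Then for all 0 < t0 < t1: (t1^(1/(1-m)) − t0^(1/(1-m))) · t1^(-m/(1-m)) · u(t1)^m ≤ (1/(1-m)) · ∫_{t0}^{t1} u(t)^m dt ≤ (t1^(1/(1-m)) − t0^(1/(1-m))) · t0^(-m/(1-m)) · u(t0)^m. -/
open Real Set MeasureTheory intervalIntegral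

/-- Two-sided bounds on the time integral of `u^m` from Bénilan–Crandall monotonicity. -/
theorem stmt_1 (m : ℝ) (hm : m ∈ Set.Ioo (0:ℝ) 1)
    (u : ℝ → ℝ) (hu_nonneg : ∀ t ∈ Set.Ioi (0:ℝ), 0 ≤ u t)
    (hu_cont : ContinuousOn u (Set.Ioi (0:ℝ)))
    (hmono : AntitoneOn (fun t => t ^ (-(1/(1-m))) * u t) (Set.Ioi (0:ℝ)))
    (t0 t1 : ℝ) (ht0 : 0 < t0) (h01 : t0 < t1) :
    (t1 ^ (1/(1-m)) - t0 ^ (1/(1-m))) * t1 ^ (-(m/(1-m))) * u t1 ^ m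
      ≤ (1/(1-m)) * ∫ t in t0..t1, u t ^ m ∧
    (1/(1-m)) * ∫ t in t0..t1, u t ^ m
      ≤ (t1 ^ (1/(1-m)) - t0 ^ (1/(1-m))) * t0 ^ (-(m/(1-m))) * u t0 ^ m := by
  obtain ⟨hm0, hm1⟩ := hm
  have h1m : 0 < 1 - m := by linarith
  have ha : 0 < m/(1-m) := div_pos hm0 h1m
  have hb : 1/(1-m) = m/(1-m) + 1 := by field_simp; ring
  have hbpos : 0 < 1/(1-m) := by positivity
  have key : ∀ s t : ℝ, 0 < s → s ≤ t →
      t ^ (-(m/(1-m))) * u t ^ m ≤ s ^ (-(m/(1-m))) * u s ^ m := by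
    intro s t hs hst
    have ht : 0 < t := lt_of_lt_of_le hs hst
    have h := hmono (mem_Ioi.2 hs) (mem_Ioi.2 ht) hst
    simp only at h
    have h2 := Real.rpow_le_rpow
      (mul_nonneg (Real.rpow_nonneg ht.le _) (hu_nonneg t ht)) h hm0.le
    rw [Real.mul_rpow (Real.rpow_nonneg ht.le _) (hu_nonneg t ht),
      Real.mul_rpow (Real.rpow_nonneg hs.le _) (hu_nonneg s hs),
      ← Real.rpow_mul ht.le, ← Real.rpow_mul hs.le] at h2
    have e : -(1/(1-m)) * m = -(m/(1-m)) := by ring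
    rwa [e] at h2
  have canc : ∀ t : ℝ, 0 < t → t ^ (m/(1-m)) * (t ^ (-(m/(1-m))) * u t ^ m) = u t ^ m := by
    intro t ht
    rw [← mul_assoc, ← Real.rpow_add ht]
    simp
  have hI : ∫ t in t0..t1, t ^ (m/(1-m))
      = (t1 ^ (1/(1-m)) - t0 ^ (1/(1-m))) / (1/(1-m)) := by
    rw [integral_rpow (Or.inl (by linarith)), hb]
  have hint : IntervalIntegrable (fun t => u t ^ m) volume t0 t1 := by
    apply ContinuousOn.intervalIntegrable
    rw [uIcc_of_le h01.le]
    exact (hu_cont.mono (fun x hx => lt_of_lt_of_le ht0 hx.1)).rpow_const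
      (fun x _ => Or.inr hm0.le)
  have hint2 : ∀ c : ℝ, IntervalIntegrable (fun t : ℝ => t ^ (m/(1-m)) * c) volume t0 t1 :=
    fun c => (intervalIntegrable_rpow' (by linarith)).mul_const c
  have hval : ∀ c : ℝ, (1/(1-m)) * ∫ t in t0..t1, t ^ (m/(1-m)) * c
      = (t1 ^ (1/(1-m)) - t0 ^ (1/(1-m))) * c := by
    intro c
    rw [intervalIntegral.integral_mul_const, hI, ← mul_assoc, mul_div_cancel₀ _ hbpos.ne']
  constructor
  · rw [mul_assoc, ← hval]
    refine mul_le_mul_of_nonneg_left ?_ hbpos.le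
    refine intervalIntegral.integral_mono_on h01.le (hint2 _) hint ?_
    intro t ht
    have htp : 0 < t := lt_of_lt_of_le ht0 ht.1
    rw [← canc t htp]
    exact mul_le_mul_of_nonneg_left (key t t1 htp ht.2) (Real.rpow_nonneg htp.le _)
  · rw [mul_assoc _ _ (u t0 ^ m), ← hval]
    refine mul_le_mul_of_nonneg_left ?_ hbpos.le
    refine intervalIntegral.integral_mono_on h01.le hint (hint2 _) ?_
    intro t ht
    have htp : 0 < t := lt_of_lt_of_le ht0 ht.1
    rw [← canc t htp]
    exact mul_le_mul_of_nonneg_left (key t0 t ht0 ht.1) (Real.rpow_nonneg htp.le _)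
end

section
/- Let m ∈ (0,1), let N be a positive integer, let p satisfy 2p > N(1-m), and set θ := 1/(2p − N(1-m)) > 0. Let T > 0, κ, D > 0, and let U, P : (0,T] → [0,∞) satisfy: (i) for all 0 < t0 < t ≤ T, U(t) ≤ κ · P(t0)^(2pθ) / (t − t0)^(Nθ); (ii) for all t ∈ [T/4, T], P(t)^p ≤ D · (T − t)^((1+m)/(1-m)). Then for every t ∈ (T/2, T): U(t) ≤ κ · 2^(Nθ) · (3/2)^(2θ(1+m)/(1-m)) · D^(2θ) · (T − t)^((1 − 2θ(p − (1+m)))/(1-m)). -/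
open Real Set

/-- Upper `L^∞` bounds close to the extinction time. -/
theorem stmt_11 (m : ℝ) (hm : m ∈ Set.Ioo (0:ℝ) 1) (N : ℕ) (hN : 0 < N)
    (p θ T κ D : ℝ) (hp : (N:ℝ)*(1-m) < 2*p) (hθ : θ = 1/(2*p - (N:ℝ)*(1-m)))
    (hT : 0 < T) (hκ : 0 < κ) (hD : 0 < D)
    (U P : ℝ → ℝ)
    (hU_nonneg : ∀ t : ℝ, 0 < t → t ≤ T → 0 ≤ U t)
    (hP_nonneg : ∀ t : ℝ, 0 < t → t ≤ T → 0 ≤ P t)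
    (hi : ∀ t0 t : ℝ, 0 < t0 → t0 < t → t ≤ T →
      U t ≤ κ * P t0 ^ (2*p*θ) / (t - t0) ^ ((N:ℝ)*θ))
    (hii : ∀ t : ℝ, T/4 ≤ t → t ≤ T → P t ^ p ≤ D * (T - t) ^ ((1+m)/(1-m))) :
    ∀ t : ℝ, T/2 < t → t < T →
      U t ≤ κ * (2:ℝ) ^ ((N:ℝ)*θ) * (3/2 : ℝ) ^ (2*θ*(1+m)/(1-m)) * D ^ (2*θ)
        * (T - t) ^ ((1 - 2*θ*(p - (1+m)))/(1-m)) := by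
  intro t ht1 ht2
  obtain ⟨hm0, hm1⟩ := hm
  have h1m : 0 < 1 - m := by linarith
  have hden : 0 < 2*p - (N:ℝ)*(1-m) := by linarith
  have hθ0 : 0 < θ := by rw [hθ]; positivity
  have hθ1 : θ * (2*p - (N:ℝ)*(1-m)) = 1 := by rw [hθ]; field_simp
  obtain ⟨s, hs⟩ : ∃ s, s = T - t := ⟨_, rfl⟩
  have hs0 : 0 < s := by linarith
  have h1 := hi (t - s/2) t (by linarith) (by linarith) ht2.le
  have h2 := hii (t - s/2) (by linarith) (by linarith)
  have hP := hP_nonneg (t - s/2) (by linarith) (by linarith)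
  rw [show t - (t - s/2) = s/2 by ring] at h1
  rw [show T - (t - s/2) = (3/2)*s by rw [hs]; ring] at h2
  rw [← hs]
  have h3 : P (t - s/2) ^ (2*p*θ) ≤ D ^ (2*θ) *
      ((3/2:ℝ) ^ (2*θ*(1+m)/(1-m)) * s ^ (2*θ*(1+m)/(1-m))) := by
    calc P (t - s/2) ^ (2*p*θ) = (P (t - s/2) ^ p) ^ (2*θ) := by
          rw [← Real.rpow_mul hP]; congr 1; ring
      _ ≤ (D * ((3/2)*s) ^ ((1+m)/(1-m))) ^ (2*θ) :=
          Real.rpow_le_rpow (Real.rpow_nonneg hP _) h2 (by positivity)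
      _ = _ := by
          rw [Real.mul_rpow hD.le (by positivity), ← Real.rpow_mul (by positivity),
            ← Real.mul_rpow (by norm_num) hs0.le]
          congr 2; ring
  have h4 : s ^ ((1 - 2*θ*(p - (1+m)))/(1-m))
      = s ^ (2*θ*(1+m)/(1-m)) / s ^ ((N:ℝ)*θ) := by
    rw [← Real.rpow_sub hs0]
    congr 1
    field_simp
    linear_combination (-1) * hθ1
  refine h1.trans ?_
  rw [h4, Real.div_rpow hs0.le (by norm_num)]
  calc κ * P (t - s/2) ^ (2*p*θ) / (s ^ ((N:ℝ)*θ) / 2 ^ ((N:ℝ)*θ))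
      ≤ κ * (D ^ (2*θ) * ((3/2:ℝ) ^ (2*θ*(1+m)/(1-m)) * s ^ (2*θ*(1+m)/(1-m))))
        / (s ^ ((N:ℝ)*θ) / 2 ^ ((N:ℝ)*θ)) := by gcongr
    _ = _ := by rw [div_div_eq_mul_div]; ring
end

section
/- Let a, κ, η > 0 and t0 ∈ ℝ. Let E : [t0 − 1, ∞) → ℝ be nonnegative, non-increasing, differentiable, with E(t) → 0 as t → ∞, and suppose that for all t ≥ t0 one has E'(t) ≤ −a·E(t) + κ·E(t−1)^η·E(t). Then there exists a constant C > 0 such that E(t) ≤ C·e^(−a·t) for all t ≥ t0. -/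
open Real Set Filter

theorem aux_gronwall (S : ℝ) (E E' G g : ℝ → ℝ)
    (hE : ∀ t, S ≤ t → HasDerivAt E (E' t) t)
    (hG : ∀ t, HasDerivAt G (g t) t)
    (h : ∀ t, S ≤ t → E' t + g t * E t ≤ 0) (t : ℝ) (ht : S ≤ t) :
    E t * Real.exp (G t) ≤ E S * Real.exp (G S) := by
  have hd : ∀ t, S ≤ t → HasDerivAt (fun t => E t * Real.exp (G t))
      (E' t * Real.exp (G t) + E t * (Real.exp (G t) * g t)) t :=
    fun t ht => (hE t ht).mul (hG t).exp
  have hanti : AntitoneOn (fun t => E t * Real.exp (G t)) (Set.Ici S) := by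
    apply antitoneOn_of_deriv_nonpos (convex_Ici S)
    · exact fun x hx => (hd x hx).continuousAt.continuousWithinAt
    · intro x hx
      exact (hd x (interior_subset hx)).differentiableAt.differentiableWithinAt
    · intro x hx
      rw [(hd x (interior_subset hx)).deriv]
      have h1 := h x (interior_subset hx)
      have h2 := mul_nonpos_of_nonpos_of_nonneg h1 (Real.exp_pos (G x)).le
      linarith
  exact hanti (Set.mem_Ici.2 le_rfl) (Set.mem_Ici.2 ht) ht

/-- Sharp decay of the entropy from the delayed differential inequality. -/
theorem stmt_15 (a κ η t0 : ℝ) (ha : 0 < a) (hκ : 0 < κ) (hη : 0 < η)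
    (E E' : ℝ → ℝ)
    (hE_nonneg : ∀ t ∈ Set.Ici (t0 - 1), 0 ≤ E t)
    (hE_anti : AntitoneOn E (Set.Ici (t0 - 1)))
    (hE_deriv : ∀ t ∈ Set.Ici (t0 - 1), HasDerivWithinAt E (E' t) (Set.Ici (t0 - 1)) t)
    (hE_lim : Tendsto E atTop (nhds 0))
    (hODE : ∀ t : ℝ, t0 ≤ t → E' t ≤ -a * E t + κ * (E (t-1)) ^ η * E t) :
    ∃ C : ℝ, 0 < C ∧ ∀ t : ℝ, t0 ≤ t → E t ≤ C * Real.exp (-(a * t)) := by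
  have hD : ∀ t, t0 ≤ t → HasDerivAt E (E' t) t := fun t ht =>
    (hE_deriv t (Set.mem_Ici.2 (by linarith))).hasDerivAt (Ici_mem_nhds (by linarith))
  have hnn : ∀ t, t0 - 1 ≤ t → 0 ≤ E t := fun t ht => hE_nonneg t ht
  have hlim2 : Tendsto (fun t => κ * (E (t - 1)) ^ η) atTop (nhds 0) := by
    have h1 : Tendsto (fun t : ℝ => E (t - 1)) atTop (nhds 0) :=
      hE_lim.comp (tendsto_atTop_add_const_right _ (-1) tendsto_id)
    have h2 := (h1.rpow_const (p := η) (Or.inr hη.le)).const_mul κ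
    rwa [Real.zero_rpow hη.ne', mul_zero] at h2
  obtain ⟨T0, hT0⟩ := eventually_atTop.1 (hlim2.eventually_le_const (show 0 < a / 2 by linarith))
  obtain ⟨T, hT, hTt⟩ : ∃ T, T0 ≤ T ∧ t0 ≤ T := ⟨max T0 t0, le_max_left _ _, le_max_right _ _⟩
  have hlin : ∀ c t : ℝ, HasDerivAt (fun t => c * t) c t := fun c t => by
    simpa using (hasDerivAt_id t).const_mul c
  -- first rough decay
  have hrough := aux_gronwall T E E' (fun t => a / 2 * t) (fun _ => a / 2)
    (fun t ht => hD t (hTt.trans ht)) (hlin (a / 2)) (by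
      intro t ht
      have h1 := hODE t (hTt.trans ht)
      have h2 := mul_le_mul_of_nonneg_right (hT0 t (hT.trans ht)) (hnn t (by linarith))
      linarith)
  set M := E T * Real.exp (a / 2 * T) with hM
  have hM0 : 0 ≤ M := mul_nonneg (hnn T (by linarith)) (Real.exp_pos _).le
  have hrough2 : ∀ t, T ≤ t → E t ≤ M * Real.exp (-(a / 2 * t)) := by
    intro t ht
    rw [Real.exp_neg, ← div_eq_mul_inv, le_div_iff₀ (Real.exp_pos _)]
    exact hrough t ht
  obtain ⟨b, hb⟩ : ∃ b, b = a / 2 * η := ⟨_, rfl⟩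
  have hb0 : 0 < b := by rw [hb]; positivity
  obtain ⟨K, hK⟩ : ∃ K, K = κ * (M ^ η * Real.exp b) := ⟨_, rfl⟩
  have hK0 : 0 ≤ K := by rw [hK]; positivity
  have hKb : ∀ t, T + 1 ≤ t → κ * (E (t - 1)) ^ η ≤ K * Real.exp (-b * t) := by
    intro t ht
    have h1 := Real.rpow_le_rpow (hnn (t-1) (by linarith)) (hrough2 (t - 1) (by linarith)) hη.le
    rw [Real.mul_rpow hM0 (Real.exp_pos _).le, ← Real.exp_mul] at h1
    have h2 : Real.exp (-(a / 2 * (t - 1)) * η) = Real.exp b * Real.exp (-b * t) := by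
      rw [← Real.exp_add, hb]; congr 1; ring
    rw [h2] at h1
    calc _ ≤ κ * (M ^ η * (Real.exp b * Real.exp (-b * t))) := mul_le_mul_of_nonneg_left h1 hκ.le
      _ = _ := by rw [hK]; ring
  have hsharp := aux_gronwall (T + 1) E E' (fun t => a * t + K / b * Real.exp (-b * t))
    (fun t => a + K / b * (Real.exp (-b * t) * (-b)))
    (fun t ht => hD t (by linarith))
    (fun t => (hlin a t).add (((hlin (-b) t).exp).const_mul (K / b))) (by
      intro t ht
      have h1 := hODE t (by linarith)
      have h2 := mul_le_mul_of_nonneg_right (hKb t ht) (hnn t (by linarith))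
      have h3 : K / b * (Real.exp (-b * t) * (-b)) = - (K * Real.exp (-b * t)) := by
        field_simp
      simp only [h3]
      linarith)
  set N := E (T + 1) * Real.exp (a * (T + 1) + K / b * Real.exp (-b * (T + 1))) with hN
  have hN0 : 0 ≤ N := mul_nonneg (hnn _ (by linarith)) (Real.exp_pos _).le
  have hP0 : 0 ≤ E t0 * Real.exp (a * (T + 1)) :=
    mul_nonneg (hnn _ (by linarith)) (Real.exp_pos _).le
  refine ⟨N + E t0 * Real.exp (a * (T + 1)) + 1, by linarith, ?_⟩
  intro t ht
  rw [Real.exp_neg, ← div_eq_mul_inv, le_div_iff₀ (Real.exp_pos _)]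
  have hEt := hnn t (by linarith)
  rcases le_total (T + 1) t with h | h
  · have h1 : Real.exp (a * t) ≤ Real.exp (a * t + K / b * Real.exp (-b * t)) := by
      apply Real.exp_le_exp.2
      have : 0 ≤ K / b * Real.exp (-b * t) := by positivity
      linarith
    have h2 := mul_le_mul_of_nonneg_left h1 hEt
    have h3 : E t * Real.exp (a * t + K / b * Real.exp (-b * t)) ≤ N := hsharp t h
    linarith
  · have h1 : Real.exp (a * t) ≤ Real.exp (a * (T + 1)) :=
      Real.exp_le_exp.2 (mul_le_mul_of_nonneg_left h ha.le)
    have h2 : E t ≤ E t0 :=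
      hE_anti (Set.mem_Ici.2 (by linarith)) (Set.mem_Ici.2 (by linarith)) ht
    have h3 := mul_le_mul h2 h1 (Real.exp_pos _).le (hnn t0 (by linarith))
    linarith
end

section
/- Let m ∈ (0,1), let q ≥ 1, let c, b > 0, let t0 ≥ 0, and let y : [t0, ∞) → ℝ be nonnegative, continuous and differentiable, satisfying y'(t) ≤ −c·y(t)^(1 − (1-m)/q) + b·y(t) for all t ≥ t0. If y(t0)^((1-m)/q) ≤ c/(2b), then: (a) y(t)^((1-m)/q) ≤ c/(2b) for all t ≥ t0; and (b) there exists t* ≤ t0 + 2q·y(t0)^((1-m)/q)/(c(1-m)) such that y(t) = 0 for all t ≥ t*. -/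
open Real Set

/-- Extinction in finite time under a small `L^q` norm: ODE core. -/
theorem stmt_17 (m q c b t0 : ℝ) (hm : m ∈ Set.Ioo (0:ℝ) 1) (hq : 1 ≤ q)
    (hc : 0 < c) (hb : 0 < b) (ht0 : 0 ≤ t0)
    (y y' : ℝ → ℝ)
    (hy_nonneg : ∀ t ∈ Set.Ici t0, 0 ≤ y t)
    (hy_cont : ContinuousOn y (Set.Ici t0))
    (hy_deriv : ∀ t ∈ Set.Ici t0, HasDerivWithinAt y (y' t) (Set.Ici t0) t)
    (hODE : ∀ t ∈ Set.Ici t0, y' t ≤ -c * y t ^ (1 - (1-m)/q) + b * y t)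
    (hsmall : y t0 ^ ((1-m)/q) ≤ c/(2*b)) :
    (∀ t ∈ Set.Ici t0, y t ^ ((1-m)/q) ≤ c/(2*b)) ∧
    (∃ tstar : ℝ, tstar ≤ t0 + 2*q*(y t0 ^ ((1-m)/q))/(c*(1-m)) ∧
      ∀ t : ℝ, tstar ≤ t → y t = 0) := by
  obtain ⟨hm0, hm1⟩ := hm
  have hq0 : 0 < q := by linarith
  obtain ⟨a, ha⟩ : ∃ a, a = (1-m)/q := ⟨_, rfl⟩
  have hT : 2*q*(y t0 ^ ((1-m)/q))/(c*(1-m)) = 2 * y t0 ^ a / (a * c) := by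
    rw [← ha]
    have h1 : 1 - m ≠ 0 := by linarith
    have h2 : 1 - m = a * q := by rw [ha]; field_simp
    rw [h2]
    have : a ≠ 0 := by
      intro h; rw [h] at h2; apply h1; linarith
    field_simp
  rw [hT]
  have ha0 : 0 < a := by rw [ha]; apply div_pos <;> linarith
  have ha1 : a < 1 := by rw [ha, div_lt_one hq0]; linarith
  rw [← ha] at hODE hsmall ⊢
  clear hT ha
  have hB : 0 < c / (2*b) := by positivity
  have hbB : b * (c / (2*b)) = c / 2 := by field_simp
  -- the key estimate
  have key : ∀ t ∈ Set.Ici t0, y t ^ a ≤ c/(2*b) → y' t ≤ -(c/2) * y t ^ (1 - a) := by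
    intro t ht h
    have h0 := hy_nonneg t ht
    have h1 : y t = y t ^ (1 - a) * y t ^ a := by
      rw [← Real.rpow_add' h0 (by norm_num)]; simp
    have h2 := hODE t ht
    have h3 : 0 ≤ y t ^ (1 - a) := Real.rpow_nonneg h0 _
    have h4 : b * y t ^ a ≤ c / 2 := by rw [← hbB]; gcongr
    have h5 : b * y t = y t ^ (1 - a) * (b * y t ^ a) := by
      calc b * y t = b * (y t ^ (1 - a) * y t ^ a) := by rw [← h1]
        _ = _ := by ring
    rw [h5] at h2
    nlinarith [mul_le_mul_of_nonneg_left h4 h3]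
  have hright : ∀ t ∈ Set.Ici t0, HasDerivWithinAt y (y' t) (Set.Ici t) t := fun t ht =>
    (hy_deriv t ht).mono (Set.Ici_subset_Ici.2 ht)
  obtain ⟨K, hK0, hK⟩ : ∃ K : ℝ, 0 < K ∧ K ^ a = c / (2*b) :=
    ⟨(c/(2*b)) ^ a⁻¹, Real.rpow_pos_of_pos hB _, Real.rpow_inv_rpow hB.le ha0.ne'⟩
  have hA : ∀ t ∈ Set.Ici t0, y t ^ a ≤ c/(2*b) := by
    intro t ht
    have hle : y t ≤ K := by
      refine image_le_of_deriv_right_lt_deriv_boundary (f := y) (f' := y') (a := t0) (b := t)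
        (B := fun _ => K) (B' := fun _ => 0) (hy_cont.mono Set.Icc_subset_Ici_self)
        (fun x hx => hright x hx.1) ?_ (fun x => hasDerivAt_const x K) ?_ ⟨ht, le_rfl⟩
      · rw [← hK] at hsmall
        exact (Real.rpow_le_rpow_iff (hy_nonneg t0 (Set.mem_Ici.2 le_rfl)) hK0.le ha0).1 hsmall
      · intro x hx hxK
        have hxK : y x = K := hxK
        have := key x hx.1 (by rw [hxK, hK])
        have h3 : 0 < y x ^ (1 - a) := Real.rpow_pos_of_pos (by rw [hxK]; exact hK0) _
        show y' x < 0
        nlinarith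
    rw [← hK]
    exact Real.rpow_le_rpow (hy_nonneg t ht) hle ha0.le
  refine ⟨hA, _, le_rfl, ?_⟩
  have hanti : AntitoneOn y (Set.Ici t0) := by
    refine antitoneOn_of_hasDerivWithinAt_nonpos (f' := y') (convex_Ici t0) hy_cont ?_ ?_
    · intro x hx
      exact (hy_deriv x (interior_subset hx)).mono interior_subset
    · intro x hx
      have hx := interior_subset hx
      have := key x hx (hA x hx)
      have h3 : 0 ≤ y x ^ (1 - a) := Real.rpow_nonneg (hy_nonneg x hx) _
      nlinarith
  intro t ht
  have hz0 : 0 ≤ y t0 ^ a := Real.rpow_nonneg (hy_nonneg t0 (Set.mem_Ici.2 le_rfl)) _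
  have hac : 0 < a * c := by positivity
  have htt : t0 ≤ t := by
    have : 0 ≤ 2 * y t0 ^ a / (a * c) := by positivity
    linarith
  by_contra hne
  have hpos : 0 < y t := lt_of_le_of_ne (hy_nonneg t htt) (Ne.symm hne)
  have hyp : ∀ x ∈ Set.Icc t0 t, 0 < y x := fun x hx =>
    hpos.trans_le (hanti hx.1 htt hx.2)
  have hd : ∀ x ∈ Set.Icc t0 t, HasDerivWithinAt (fun x => y x ^ a + (a * c / 2) * x)
      (y' x * a * y x ^ (a - 1) + (a * c / 2) * 1) (Set.Icc t0 t) x := by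
    intro x hx
    exact (((hy_deriv x hx.1).mono Set.Icc_subset_Ici_self).rpow_const
      (Or.inl (hyp x hx).ne')).add ((hasDerivWithinAt_id x _).const_mul _)
  have hanti2 : AntitoneOn (fun x => y x ^ a + (a * c / 2) * x) (Set.Icc t0 t) := by
    refine antitoneOn_of_hasDerivWithinAt_nonpos (convex_Icc t0 t)
      (fun x hx => (hd x hx).continuousWithinAt)
      (fun x hx => (hd x (interior_subset hx)).mono interior_subset) ?_
    intro x hx
    have hx := interior_subset hx
    have h1 := key x hx.1 (hA x hx.1)
    have hp := hyp x hx
    have h2 : y x ^ (1 - a) * y x ^ (a - 1) = 1 := by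
      rw [← Real.rpow_add hp]; simp
    have h3 : 0 < y x ^ (a - 1) := Real.rpow_pos_of_pos hp _
    have h4 := mul_le_mul_of_nonneg_right h1 (mul_pos ha0 h3).le
    have h5 : -(c/2) * y x ^ (1 - a) * (a * y x ^ (a - 1)) = -(a * c / 2) := by
      calc _ = -(c/2) * a * (y x ^ (1 - a) * y x ^ (a - 1)) := by ring
        _ = _ := by rw [h2]; ring
    rw [h5] at h4
    linarith
  have hfin := hanti2 (Set.left_mem_Icc.2 htt) (Set.right_mem_Icc.2 htt) htt
  have hzt : 0 < y t ^ a := Real.rpow_pos_of_pos hpos _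
  have h6 : 2 * y t0 ^ a / (a * c) ≤ t - t0 := by linarith
  rw [div_le_iff₀ hac] at h6
  simp only at hfin
  nlinarith
end
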